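/- arXiv:1010.4275 — 3 statements merged into one kernel-verified Lean document; each statement's English description precedes it below -/
import Mathlib

section
/- Let n ≥ 3 be an integer, let A, a, L > 0 be real constants, and let R : [0, ∞) → ℝ be a continuous nondecreasing function with R(t) > a for all t ≥ 0 and lim_{t→∞} R(t) / (c · t^{1/n}) = 1, where c = (A · a^{n−2} · n · (n−2) / L)^{1/n}. Define p(x,t) = A · a^{2−n} · (|x|^{2−n} − R(t)^{2−n})₊ / (a^{2−n} − R(t)^{2−n}) for x ∈ ℝⁿ \ {0}, t ≥ 0, and for λ > 0 set p^λ(x,t) = λ^{(n−2)/n} · p(λ^{1/n} x, λ t). Then, as λ → ∞, p^λ converges to the function W(x,t) = A · (|x|^{2−n} − (c · t^{1/n})^{2−n})₊ uniformly on every set {(x,t) : |x| ≥ ε, 0 ≤ t ≤ T} with ε > 0 and T > 0. -/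
open Real Filter

/-- If `R t ~ c t ^ e` for a nonnegative monotone `R`, the rescalings `R (lam t) / lam ^ e` converge
to `c t ^ e` uniformly on `[0, T]`. -/
lemma eventually_abs_rescaled_sub_lt {R : ℝ → ℝ} {c e : ℝ} (hc : 0 < c) (he : 0 < e)
    (hRmono : MonotoneOn R (Set.Ici (0 : ℝ))) (hRnonneg : ∀ t, 0 ≤ t → 0 ≤ R t)
    (hR : Tendsto (fun t : ℝ => R t / (c * t ^ e)) atTop (nhds 1))
    {T δ : ℝ} (hT : 0 < T) (hδ : 0 < δ) :
    ∀ᶠ lam : ℝ in atTop, ∀ t, 0 ≤ t → t ≤ T → |R (lam * t) / lam ^ e - c * t ^ e| < δ := by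
  have hB : 0 < c * T ^ e := by positivity
  obtain ⟨τ₁, hτ₁⟩ := eventually_atTop.1
    (Metric.tendsto_nhds.1 hR (δ / (c * T ^ e)) (by positivity))
  set τ := max τ₁ 1 with hτ
  have hτ_pos : 0 < τ := lt_of_lt_of_le one_pos (le_max_right _ _)
  have hpow : Tendsto (fun lam : ℝ => lam ^ e) atTop atTop := tendsto_rpow_atTop he
  have h1 : ∀ᶠ lam : ℝ in atTop, R τ / lam ^ e < δ :=
    (hpow.const_div_atTop (R τ)).eventually (gt_mem_nhds hδ)
  have h2 : ∀ᶠ lam : ℝ in atTop, c * τ ^ e / lam ^ e < δ :=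
    (hpow.const_div_atTop (c * τ ^ e)).eventually (gt_mem_nhds hδ)
  filter_upwards [h1, h2, eventually_gt_atTop 0] with lam h1 h2 hlam t ht htT
  have hl : 0 < lam ^ e := rpow_pos_of_pos hlam e
  have hlt : 0 ≤ lam * t := by positivity
  have hmul : (lam * t) ^ e = lam ^ e * t ^ e := mul_rpow hlam.le ht
  rcases le_or_gt τ (lam * t) with h | h
  · have ht' : 0 < t := by
      by_contra! h0
      have : t = 0 := le_antisymm h0 ht
      subst this
      simp only [mul_zero] at h
      linarith
    have hte : 0 < t ^ e := rpow_pos_of_pos ht' e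
    have hd := hτ₁ (lam * t) ((le_max_left _ _).trans h)
    rw [Real.dist_eq, hmul] at hd
    have hEq : R (lam * t) / lam ^ e - c * t ^ e
        = (R (lam * t) / (c * (lam ^ e * t ^ e)) - 1) * (c * t ^ e) := by
      field_simp
    rw [hEq, abs_mul, abs_of_pos (mul_pos hc hte)]
    have hle : c * t ^ e ≤ c * T ^ e :=
      mul_le_mul_of_nonneg_left (rpow_le_rpow ht htT he.le) hc.le
    calc _ < δ / (c * T ^ e) * (c * t ^ e) := mul_lt_mul_of_pos_right hd (mul_pos hc hte)
      _ ≤ δ / (c * T ^ e) * (c * T ^ e) := mul_le_mul_of_nonneg_left hle (by positivity)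
      _ = δ := by field_simp
  · have hs : R (lam * t) / lam ^ e ≤ R τ / lam ^ e :=
      div_le_div_of_nonneg_right (hRmono hlt hτ_pos.le h.le) hl.le
    have hs0 : 0 ≤ R (lam * t) / lam ^ e := div_nonneg (hRnonneg _ hlt) hl.le
    have hσ : c * t ^ e ≤ c * τ ^ e / lam ^ e := by
      rw [le_div_iff₀ hl, mul_assoc, mul_comm (t ^ e), ← hmul]
      exact mul_le_mul_of_nonneg_left (rpow_le_rpow hlt h.le he.le) hc.le
    have hσ0 : 0 ≤ c * t ^ e := by positivity
    rw [abs_lt]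
    constructor <;> linarith

/-- A negative power, truncated near the origin, is uniformly continuous. -/
lemma uniformContinuous_max_abs_rpow {ε k : ℝ} (hε : 0 < ε) (hk : k < 0) :
    UniformContinuous fun s : ℝ => (max ε |s|) ^ k := by
  have hcont : Continuous fun s : ℝ => (max ε |s|) ^ k :=
    (continuous_const.max continuous_abs).rpow_const
      fun s => Or.inl (lt_of_lt_of_le hε (le_max_left _ _)).ne'
  refine hcont.uniformContinuous_of_tendsto_cocompact (x := 0) ?_
  have habs : Tendsto (fun s : ℝ => max ε |s|) (cocompact ℝ) atTop :=
    tendsto_atTop_mono (fun s => le_max_right _ _) (tendsto_norm_cocompact_atTop (E := ℝ))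
  have := (tendsto_rpow_neg_atTop (neg_pos.2 hk)).comp habs
  simpa [Function.comp_def] using this

/-- The positive part of a difference of negative powers in terms of the truncated power. -/
lemma max_rpow_sub_rpow {ε r s k : ℝ} (hε : 0 < ε) (hk : k < 0) (hr : ε ≤ r) (hs : 0 < s) :
    max (r ^ k - s ^ k) 0 = r ^ k - min (r ^ k) ((max ε |s|) ^ k) := by
  rw [abs_of_pos hs]
  have hrε : r ^ k ≤ ε ^ k := rpow_le_rpow_of_nonpos hε hr hk.le
  rcases le_total s ε with h | h
  · have : ε ^ k ≤ s ^ k := rpow_le_rpow_of_nonpos hs h hk.le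
    rw [max_eq_left h, min_eq_left hrε, max_eq_right (by linarith)]
    ring
  · rw [max_eq_right h]
    rcases le_total (r ^ k) (s ^ k) with h' | h'
    · rw [min_eq_left h', max_eq_right (by linarith)]
      ring
    · rw [min_eq_right h', max_eq_left (by linarith)]

/-- The normalizing factor of the radial solution tends to `1` as the radius tends to infinity. -/
lemma tendsto_inv_one_sub_rpow {k : ℝ} (hk : k < 0) :
    Tendsto (fun u : ℝ => (1 - u ^ k)⁻¹) atTop (nhds 1) := by
  have h : Tendsto (fun u : ℝ => u ^ k) atTop (nhds 0) := by
    simpa using tendsto_rpow_neg_atTop (neg_pos.2 hk)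
  simpa using (h.const_sub 1).inv₀ (by norm_num)

/-- Scaling identity for the radial solution. -/
lemma rescaled_radial_eq {A a μ r ρ k : ℝ} (ha : 0 < a) (hμ : 0 < μ) (hr : 0 < r) (hρ : 0 < ρ) :
    μ ^ (-k) * (A * a ^ k * max ((μ * r) ^ k - ρ ^ k) 0 / (a ^ k - ρ ^ k))
      = A * max (r ^ k - (ρ / μ) ^ k) 0 * (1 - (ρ / a) ^ k)⁻¹ := by
  have hμk : 0 < μ ^ k := rpow_pos_of_pos hμ k
  have hak : 0 < a ^ k := rpow_pos_of_pos ha k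
  have h1 : max ((μ * r) ^ k - ρ ^ k) 0 = μ ^ k * max (r ^ k - (ρ / μ) ^ k) 0 := by
    rw [mul_max_of_nonneg _ _ hμk.le, mul_zero, mul_rpow hμ.le hr.le, div_rpow hρ.le hμ.le]
    congr 1
    field_simp
  have h2 : a ^ k - ρ ^ k = a ^ k * (1 - (ρ / a) ^ k) := by
    rw [div_rpow hρ.le ha.le]
    field_simp
  rw [h1, h2, rpow_neg hμ.le, div_eq_mul_inv, mul_inv]
  field_simp

/-- Locally uniform convergence of the rescaled radially symmetric Hele-Shaw solutions,
`n ≥ 3`: with `p(x,t) = A a^{2−n} (|x|^{2−n} − R(t)^{2−n})₊ / (a^{2−n} − R(t)^{2−n})` and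
`p^λ(x,t) = λ^{(n−2)/n} p(λ^{1/n} x, λt)`, one has `p^λ → W` uniformly on every set
`{|x| ≥ ε, 0 ≤ t ≤ T}`, where `W(x,t) = A (|x|^{2−n} − (c t^{1/n})^{2−n})₊` for `t > 0`
and `W(x,0) = 0` (the point-source solution). -/
theorem stmt_7 (n : ℕ) (hn : 3 ≤ n) (A a L : ℝ) (hA : 0 < A) (ha : 0 < a) (hL : 0 < L)
    (R : ℝ → ℝ) (hRcont : ContinuousOn R (Set.Ici (0:ℝ)))
    (hRmono : MonotoneOn R (Set.Ici (0:ℝ)))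
    (hRa : ∀ t : ℝ, 0 ≤ t → a < R t)
    (c : ℝ) (hc : c = (A * a ^ ((n : ℝ) - 2) * n * (n - 2) / L) ^ ((1 : ℝ) / n))
    (hRasymp : Tendsto (fun t : ℝ => R t / (c * t ^ ((1 : ℝ) / n))) atTop (nhds 1))
    (p : EuclideanSpace ℝ (Fin n) → ℝ → ℝ)
    (hp : ∀ x : EuclideanSpace ℝ (Fin n), x ≠ 0 → ∀ t : ℝ, 0 ≤ t →
      p x t = A * a ^ ((2 : ℝ) - n) * max (‖x‖ ^ ((2 : ℝ) - n) - (R t) ^ ((2 : ℝ) - n)) 0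
                / (a ^ ((2 : ℝ) - n) - (R t) ^ ((2 : ℝ) - n)))
    (W : EuclideanSpace ℝ (Fin n) → ℝ → ℝ)
    (hWpos : ∀ x : EuclideanSpace ℝ (Fin n), ∀ t : ℝ, 0 < t →
      W x t = A * max (‖x‖ ^ ((2 : ℝ) - n) - (c * t ^ ((1 : ℝ) / n)) ^ ((2 : ℝ) - n)) 0)
    (hW0 : ∀ x : EuclideanSpace ℝ (Fin n), W x 0 = 0) :
    ∀ ε : ℝ, 0 < ε → ∀ T : ℝ, 0 < T →
      TendstoUniformlyOn
        (fun (lam : ℝ) (q : EuclideanSpace ℝ (Fin n) × ℝ) =>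
          lam ^ (((n : ℝ) - 2) / n) * p ((lam ^ ((1 : ℝ) / n)) • q.1) (lam * q.2))
        (fun q => W q.1 q.2) atTop
        {q : EuclideanSpace ℝ (Fin n) × ℝ | ε ≤ ‖q.1‖ ∧ 0 ≤ q.2 ∧ q.2 ≤ T} := by
  intro ε hε T hT
  have hn3 : (3 : ℝ) ≤ n := by exact_mod_cast hn
  set k : ℝ := 2 - n with hk_def
  set e : ℝ := 1 / n with he_def
  have hk : k < 0 := by linarith
  have he : 0 < e := by positivity
  have hcpos : 0 < c := by
    rw [hc]
    have : (0 : ℝ) < n - 2 := by linarith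
    positivity
  have hexp : ∀ lam : ℝ, 0 < lam → lam ^ (((n : ℝ) - 2) / n) = (lam ^ e) ^ (-k) := by
    intro lam hlam
    rw [← rpow_mul hlam.le]
    congr 1
    rw [he_def, hk_def]
    ring
  have hRpos : ∀ t, 0 ≤ t → 0 < R t := fun t ht => ha.trans (hRa t ht)
  rw [Metric.tendstoUniformlyOn_iff]
  intro η hη
  have hεk : 0 < ε ^ k := rpow_pos_of_pos hε k
  obtain ⟨δ, hδ, hunif⟩ := Metric.uniformContinuous_iff.1
    (uniformContinuous_max_abs_rpow hε hk) (η / (2 * A)) (by positivity)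
  have hrad := eventually_abs_rescaled_sub_lt hcpos he hRmono (fun t ht => (hRpos t ht).le)
    hRasymp hT hδ
  obtain ⟨u₀, hu₀⟩ := eventually_atTop.1 (Metric.tendsto_nhds.1 (tendsto_inv_one_sub_rpow hk)
    (η / (2 * (A * ε ^ k))) (by positivity))
  have hlarge : ∀ᶠ lam : ℝ in atTop, u₀ * a / ε ≤ lam ^ e :=
    (tendsto_rpow_atTop he).eventually_ge_atTop _
  filter_upwards [hrad, hlarge, eventually_gt_atTop 0] with lam hrad hlarge hlam
  rintro ⟨x, t⟩ ⟨hx, ht, htT⟩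
  simp only at hx ht htT ⊢
  set μ := lam ^ e with hμ_def
  have hμ : 0 < μ := rpow_pos_of_pos hlam e
  have hr : 0 < ‖x‖ := hε.trans_le hx
  have hlt : 0 ≤ lam * t := by positivity
  have hρ := hRpos _ hlt
  set ρ := R (lam * t) with hρ_def
  have hx0 : μ • x ≠ 0 := smul_ne_zero hμ.ne' (norm_pos_iff.1 hr)
  rw [hp _ hx0 _ hlt, hexp _ hlam, norm_smul, Real.norm_of_nonneg hμ.le,
    rescaled_radial_eq ha hμ hr hρ]
  have hrk : ‖x‖ ^ k ≤ ε ^ k := rpow_le_rpow_of_nonpos hε hx hk.le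
  have hW : W x t = A * (‖x‖ ^ k - min (‖x‖ ^ k) ((max ε |c * t ^ e|) ^ k)) := by
    rcases ht.eq_or_lt with h0 | h0
    · rw [← h0, hW0, zero_rpow he.ne', mul_zero, abs_zero, max_eq_left hε.le, min_eq_left hrk]
      ring
    · rw [hWpos x t h0, max_rpow_sub_rpow hε hk hx (by positivity)]
  have hs : 0 < ρ / μ := div_pos hρ hμ
  set M := max (‖x‖ ^ k - (ρ / μ) ^ k) 0 with hM
  have hM0 : 0 ≤ M := le_max_right _ _
  have hMle : M ≤ ε ^ k := by
    refine max_le ?_ hεk.le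
    have := rpow_pos_of_pos hs k
    linarith
  have hfirst : |W x t - A * M| < η / 2 := by
    have hd := hunif (hrad t ht htT)
    rw [Real.dist_eq] at hd
    have hmin := abs_min_sub_min_le_max (‖x‖ ^ k) ((max ε |ρ / μ|) ^ k)
      (‖x‖ ^ k) ((max ε |c * t ^ e|) ^ k)
    rw [sub_self, abs_zero, max_eq_right (a := (0 : ℝ)) (abs_nonneg _)] at hmin
    rw [hW, hM, max_rpow_sub_rpow hε hk hx hs, ← mul_sub, abs_mul, abs_of_pos hA]
    rw [sub_sub_sub_cancel_left]
    calc _ < A * (η / (2 * A)) := mul_lt_mul_of_pos_left (hmin.trans_lt hd) hA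
      _ = η / 2 := by field_simp
  have hsecond : |A * M - A * M * (1 - (ρ / a) ^ k)⁻¹| ≤ η / 2 := by
    rcases hM0.eq_or_lt with h | h
    · rw [← h]
      simp only [mul_zero, zero_mul, sub_zero, abs_zero]
      positivity
    · have hlt' : ‖x‖ < ρ / μ := by
        by_contra! hle
        have := rpow_le_rpow_of_nonpos hs hle hk.le
        rw [hM, max_eq_right (by linarith)] at h
        exact lt_irrefl _ h
      have hu : u₀ ≤ ρ / a := by
        rw [div_le_iff₀ hε] at hlarge
        rw [le_div_iff₀ ha]
        have := (lt_div_iff₀ hμ).1 (hx.trans_lt hlt')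
        linarith
      have hd := hu₀ _ hu
      rw [dist_comm, Real.dist_eq] at hd
      have hEq : A * M - A * M * (1 - (ρ / a) ^ k)⁻¹
          = A * M * (1 - (1 - (ρ / a) ^ k)⁻¹) := by ring
      rw [hEq, abs_mul, abs_of_nonneg (by positivity)]
      calc _ ≤ A * ε ^ k * (η / (2 * (A * ε ^ k))) :=
            mul_le_mul (mul_le_mul_of_nonneg_left hMle hA.le) hd.le (abs_nonneg _) (by positivity)
        _ = η / 2 := by field_simp
  rw [Real.dist_eq]
  have := abs_sub_le (W x t) (A * M) (A * M * (1 - (ρ / a) ^ k)⁻¹)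
  linarith
end

section
/- Let A, a, L > 0 be real constants and let R : [0, ∞) → ℝ be a continuous nondecreasing function with R(t) > a for all t ≥ 0, satisfying lim_{t→∞} R(t) / (2 (A/L)^{1/2} (t / log t)^{1/2}) = 1 and lim_{t→∞} (log R(t)) / (log t) = 1/2. Define p(x,t) = A · (log(R(t)/|x|))₊ / log(R(t)/a) for x ∈ ℝ² \ {0}, t ≥ 0, and for λ > 0 set p^λ(x,t) = log R(λ) · p(R(λ) x, λ t), where R(λ) is the unique r > 1 with r² log r = λ. Then, as λ → ∞, p^λ converges to the function W(x,t) = A · (log(ρ(t)/|x|))₊ with ρ(t) = (2At/L)^{1/2}, uniformly on every set {(x,t) : |x| ≥ ε, 0 ≤ t ≤ T} with ε > 0 and T > 0. -/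
open Real Filter

/-- If `r² log r = λ` then `r → ∞` as `λ → ∞`. -/
lemma tendsto_atTop_of_sq_mul_log_eq {R : ℝ → ℝ}
    (hR : ∀ lam : ℝ, 0 < lam → 1 < R lam ∧ (R lam) ^ 2 * Real.log (R lam) = lam) :
    Tendsto R atTop atTop := by
  refine tendsto_atTop.2 fun b => ?_
  filter_upwards [eventually_gt_atTop ((max b 1) ^ 3)] with lam hlam
  have h1 : (1 : ℝ) ≤ max b 1 := le_max_right _ _
  have hpos : 0 < lam := lt_trans (by positivity) hlam
  obtain ⟨hr, he⟩ := hR lam hpos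
  by_contra! hb
  have hle : R lam ≤ max b 1 := hb.le.trans (le_max_left _ _)
  have hlog : Real.log (R lam) ≤ R lam := Real.log_le_self (by linarith)
  have h3 : lam ≤ (R lam) ^ 3 := by
    calc lam = (R lam) ^ 2 * Real.log (R lam) := he.symm
      _ ≤ (R lam) ^ 2 * R lam := by gcongr
      _ = (R lam) ^ 3 := by ring
  have h4 : (R lam) ^ 3 ≤ (max b 1) ^ 3 := by gcongr
  linarith

/-- The times `λ t` tend to infinity uniformly for `t` bounded away from zero. -/
lemma tendsto_mul_atTop_prod_principal {δ T : ℝ} (hδ : 0 < δ) :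
    Tendsto (fun z : ℝ × ℝ => z.1 * z.2) (atTop ×ˢ 𝓟 (Set.Icc δ T)) atTop := by
  have h : Tendsto (fun z : ℝ × ℝ => z.1 * δ) (atTop ×ˢ 𝓟 (Set.Icc δ T)) atTop :=
    tendsto_fst.atTop_mul_const hδ
  refine tendsto_atTop_mono' _ ?_ h
  filter_upwards [prod_mem_prod (eventually_gt_atTop (0 : ℝ)) (mem_principal_self (Set.Icc δ T))]
    with z hz
  exact mul_le_mul_of_nonneg_left hz.2.1 (le_of_lt hz.1)

lemma tendsto_log_mul_div_log {R : ℝ → ℝ}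
    (hR : ∀ lam : ℝ, 0 < lam → 1 < R lam ∧ (R lam) ^ 2 * Real.log (R lam) = lam)
    {δ T : ℝ} (hδ : 0 < δ) :
    Tendsto (fun z : ℝ × ℝ => Real.log (z.1 * z.2) / Real.log (R z.1))
      (atTop ×ˢ 𝓟 (Set.Icc δ T)) (nhds 2) := by
  have hl : Tendsto (fun z : ℝ × ℝ => Real.log (R z.1)) (atTop ×ˢ 𝓟 (Set.Icc δ T)) atTop :=
    (Real.tendsto_log_atTop.comp (tendsto_atTop_of_sq_mul_log_eq hR)).comp tendsto_fst
  have h1 : Tendsto (fun z : ℝ × ℝ => Real.log (Real.log (R z.1)) / Real.log (R z.1))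
      (atTop ×ˢ 𝓟 (Set.Icc δ T)) (nhds 0) :=
    (Real.isLittleO_log_id_atTop.tendsto_div_nhds_zero).comp hl
  have h2 : Tendsto (fun z : ℝ × ℝ => Real.log z.2 / Real.log (R z.1))
      (atTop ×ˢ 𝓟 (Set.Icc δ T)) (nhds 0) := by
    refine tendsto_of_tendsto_of_tendsto_of_le_of_le'
      (hl.const_div_atTop (Real.log δ)) (hl.const_div_atTop (Real.log T)) ?_ ?_
    all_goals
      filter_upwards [prod_mem_prod (eventually_gt_atTop (0 : ℝ))
        (mem_principal_self (Set.Icc δ T))] with z hz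
      have hlog : 0 < Real.log (R z.1) := Real.log_pos (hR z.1 hz.1).1
      have hz2 : 0 < z.2 := hδ.trans_le hz.2.1
    · exact div_le_div_of_nonneg_right (Real.log_le_log hδ hz.2.1) hlog.le
    · exact div_le_div_of_nonneg_right (Real.log_le_log hz2 hz.2.2) hlog.le
  have h3 := (h1.add h2).const_add 2
  simp only [add_zero] at h3
  refine h3.congr' ?_
  filter_upwards [prod_mem_prod (eventually_gt_atTop (0 : ℝ))
    (mem_principal_self (Set.Icc δ T))] with z hz
  obtain ⟨hr, he⟩ := hR z.1 hz.1
  have hlog : 0 < Real.log (R z.1) := Real.log_pos hr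
  have hz1 : z.1 ≠ 0 := ne_of_gt hz.1
  have hz2 : z.2 ≠ 0 := (hδ.trans_le hz.2.1).ne'
  have hlam : Real.log z.1 = 2 * Real.log (R z.1) + Real.log (Real.log (R z.1)) := by
    conv_lhs => rw [← he]
    rw [Real.log_mul (by positivity) hlog.ne', Real.log_pow]
    norm_num
  rw [Real.log_mul hz1 hz2, hlam]
  field_simp
  ring

/-- The coefficient `log R(λ) / log (S(λt)/a)` tends to `1`, uniformly in `t ∈ [δ, T]`. -/
lemma tendsto_log_div_log_radius {a : ℝ} (ha : 0 < a) {S R : ℝ → ℝ}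
    (hSa : ∀ t : ℝ, 0 ≤ t → a < S t)
    (hSlog : Tendsto (fun t : ℝ => Real.log (S t) / Real.log t) atTop (nhds (1/2)))
    (hR : ∀ lam : ℝ, 0 < lam → 1 < R lam ∧ (R lam) ^ 2 * Real.log (R lam) = lam)
    {δ T : ℝ} (hδ : 0 < δ) :
    Tendsto (fun z : ℝ × ℝ => Real.log (R z.1) / Real.log (S (z.1 * z.2) / a))
      (atTop ×ˢ 𝓟 (Set.Icc δ T)) (nhds 1) := by
  have hl : Tendsto (fun z : ℝ × ℝ => Real.log (R z.1)) (atTop ×ˢ 𝓟 (Set.Icc δ T)) atTop :=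
    (Real.tendsto_log_atTop.comp (tendsto_atTop_of_sq_mul_log_eq hR)).comp tendsto_fst
  have hm := tendsto_mul_atTop_prod_principal (T := T) hδ
  have h := (((hSlog.comp hm).mul (tendsto_log_mul_div_log hR hδ)).sub
    (hl.const_div_atTop (Real.log a))).inv₀ (by norm_num)
  norm_num at h
  refine h.congr' ?_
  filter_upwards [prod_mem_prod (eventually_gt_atTop (0 : ℝ)) (mem_principal_self (Set.Icc δ T)),
    hm.eventually_gt_atTop 1] with z hz hz'
  have hlog : 0 < Real.log (R z.1) := Real.log_pos (hR z.1 hz.1).1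
  have hlog' : 0 < Real.log (z.1 * z.2) := Real.log_pos hz'
  have hS := hSa (z.1 * z.2) (by linarith)
  rw [Real.log_div (ha.trans hS).ne' ha.ne', ← inv_div]
  field_simp

/-- The rescaled radius `S(λt)/R(λ)` is asymptotic to `ρ(t)`, uniformly in `t ∈ [δ, T]`. -/
lemma tendsto_log_rescaled_radius_sub {A a L : ℝ} (hA : 0 < A) (ha : 0 < a) (hL : 0 < L)
    {S R : ℝ → ℝ} (hSa : ∀ t : ℝ, 0 ≤ t → a < S t)
    (hSasymp : Tendsto
      (fun t : ℝ => S t / (2 * Real.sqrt (A / L) * Real.sqrt (t / Real.log t)))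
      atTop (nhds 1))
    (hR : ∀ lam : ℝ, 0 < lam → 1 < R lam ∧ (R lam) ^ 2 * Real.log (R lam) = lam)
    {δ T : ℝ} (hδ : 0 < δ) :
    Tendsto (fun z : ℝ × ℝ =>
        Real.log (S (z.1 * z.2) / R z.1) - Real.log (Real.sqrt (2 * A * z.2 / L)))
      (atTop ×ˢ 𝓟 (Set.Icc δ T)) (nhds 0) := by
  have hm := tendsto_mul_atTop_prod_principal (T := T) hδ
  have h1 := (((tendsto_log_mul_div_log (T := T) hR hδ).inv₀ two_ne_zero).const_mul 2).sqrt
  have h2 := ((hSasymp.comp hm).mul h1).log (by norm_num)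
  norm_num at h2
  refine h2.congr' ?_
  filter_upwards [prod_mem_prod (eventually_gt_atTop (0 : ℝ)) (mem_principal_self (Set.Icc δ T)),
    hm.eventually_gt_atTop 1] with z hz hz'
  obtain ⟨hr, he⟩ := hR z.1 hz.1
  have hz1 : 0 < z.1 := hz.1
  have hz2 : 0 < z.2 := hδ.trans_le hz.2.1
  have hr0 : 0 < R z.1 := by linarith
  have hlog : 0 < Real.log (R z.1) := Real.log_pos hr
  have hlog' : 0 < Real.log (z.1 * z.2) := Real.log_pos hz'
  have hS : 0 < S (z.1 * z.2) := ha.trans (hSa _ (by linarith))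
  have hden : 2 * √(A / L) * √(z.1 * z.2 / Real.log (z.1 * z.2)) =
      R z.1 * √(2 * A * z.2 / L) * √(2 * (Real.log (R z.1) / Real.log (z.1 * z.2))) := by
    rw [← pow_left_inj₀ (by positivity) (by positivity) two_ne_zero]
    simp only [mul_pow]
    rw [Real.sq_sqrt (by positivity), Real.sq_sqrt (by positivity), Real.sq_sqrt (by positivity),
      Real.sq_sqrt (by positivity)]
    conv_lhs => enter [2, 1, 1]; rw [← he]
    ring
  rw [← Real.log_div (by positivity) (by positivity)]
  congr 1
  rw [hden, Real.sqrt_mul zero_le_two]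
  have h3 : 0 < √(Real.log (R z.1) / Real.log (z.1 * z.2)) := by positivity
  have h4 : 0 < √(2 * A * z.2 / L) := by positivity
  generalize √(Real.log (R z.1) / Real.log (z.1 * z.2)) = v at h3 ⊢
  generalize √(2 * A * z.2 / L) = w at h4 ⊢
  field_simp

/-- Comparison of two rescaled positive parts of logarithms. -/
lemma abs_mul_max_sub_le {c u v M : ℝ} (hv : v ≤ M) :
    |c * max u 0 - max v 0| ≤ |c| * |u - v| + |c - 1| * max M 0 := by
  have h1 : |max u 0 - max v 0| ≤ |u - v| := by
    simpa using abs_max_sub_max_le_abs u v 0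
  have h2 : max v 0 ≤ max M 0 := max_le_max_right 0 hv
  calc |c * max u 0 - max v 0| = |c * (max u 0 - max v 0) + (c - 1) * max v 0| := by ring_nf
    _ ≤ |c| * |max u 0 - max v 0| + |c - 1| * max v 0 := by
      refine (abs_add_le _ _).trans_eq ?_
      rw [abs_mul, abs_mul, abs_of_nonneg (le_max_right v 0)]
    _ ≤ |c| * |u - v| + |c - 1| * max M 0 := by gcongr

/-- Locally uniform convergence of the rescaled radially symmetric Hele-Shaw solutions in
dimension `n = 2`: with `p(x,t) = A (log(S(t)/|x|))₊ / log(S(t)/a)` (free boundary radius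
`S(t)`) and `p^λ(x,t) = log R(λ) · p(R(λ) x, λt)`, where `R(λ)` is the unique `r > 1` with
`r² log r = λ`, one has `p^λ → W` uniformly on every set `{|x| ≥ ε, 0 ≤ t ≤ T}`, where
`W(x,t) = A (log(ρ(t)/|x|))₊` with `ρ(t) = (2At/L)^{1/2}`. -/
theorem stmt_8 (A a L : ℝ) (hA : 0 < A) (ha : 0 < a) (hL : 0 < L)
    (S : ℝ → ℝ) (hScont : ContinuousOn S (Set.Ici (0:ℝ)))
    (hSmono : MonotoneOn S (Set.Ici (0:ℝ)))
    (hSa : ∀ t : ℝ, 0 ≤ t → a < S t)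
    (hSasymp : Tendsto
      (fun t : ℝ => S t / (2 * Real.sqrt (A / L) * Real.sqrt (t / Real.log t)))
      atTop (nhds 1))
    (hSlog : Tendsto (fun t : ℝ => Real.log (S t) / Real.log t) atTop (nhds (1/2)))
    (R : ℝ → ℝ)
    (hR : ∀ lam : ℝ, 0 < lam → 1 < R lam ∧ (R lam) ^ 2 * Real.log (R lam) = lam)
    (p : EuclideanSpace ℝ (Fin 2) → ℝ → ℝ)
    (hp : ∀ x : EuclideanSpace ℝ (Fin 2), x ≠ 0 → ∀ t : ℝ, 0 ≤ t →
      p x t = A * max (Real.log (S t / ‖x‖)) 0 / Real.log (S t / a)) :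
    ∀ ε : ℝ, 0 < ε → ∀ T : ℝ, 0 < T →
      TendstoUniformlyOn
        (fun (lam : ℝ) (q : EuclideanSpace ℝ (Fin 2) × ℝ) =>
          Real.log (R lam) * p ((R lam) • q.1) (lam * q.2))
        (fun q => A * max (Real.log (Real.sqrt (2 * A * q.2 / L) / ‖q.1‖)) 0) atTop
        {q : EuclideanSpace ℝ (Fin 2) × ℝ | ε ≤ ‖q.1‖ ∧ 0 ≤ q.2 ∧ q.2 ≤ T} := by
  intro ε hε T hT
  set ρ : ℝ → ℝ := fun t => √(2 * A * t / L) with hρ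
  have hρmono : Monotone ρ := fun s t hst => by
    simp only [hρ]
    gcongr
  obtain ⟨δ, hδ, hδT, hρδ⟩ : ∃ δ, 0 < δ ∧ δ ≤ T ∧ ρ δ < ε := by
    have hc : Continuous ρ := by fun_prop
    have h0 : ∀ᶠ t in nhdsWithin (0 : ℝ) (Set.Ioi 0), ρ t < ε :=
      (hc.tendsto 0).mono_left nhdsWithin_le_nhds |>.eventually_lt_const (by simpa [hρ] using hε)
    obtain ⟨δ, h1, h2⟩ := (h0.and (Ioc_mem_nhdsGT hT)).exists
    exact ⟨δ, h2.1, h2.2, h1⟩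
  have hc := tendsto_log_div_log_radius (T := T) ha hSa hSlog hR hδ
  have hD := tendsto_log_rescaled_radius_sub (T := T) hA ha hL hSa hSasymp hR hδ
  set M := Real.log (ρ T / ε) with hM
  have hρpos : ∀ t, 0 < t → 0 < ρ t := fun t ht => by
    simp only [hρ]
    positivity
  have hbound : Tendsto (fun z : ℝ × ℝ =>
      A * (|Real.log (R z.1) / Real.log (S (z.1 * z.2) / a)| *
        |Real.log (S (z.1 * z.2) / R z.1) - Real.log (ρ z.2)| +
        |Real.log (R z.1) / Real.log (S (z.1 * z.2) / a) - 1| * max M 0))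
      (atTop ×ˢ 𝓟 (Set.Icc δ T)) (nhds 0) := by
    have h := ((hc.abs.mul hD.abs).add ((hc.sub_const 1).abs.mul_const (max M 0))).const_mul A
    simpa using h
  have hsmall : ∀ᶠ lam in atTop, S (lam * δ) / R lam < ε := by
    have hpair : Tendsto (fun lam : ℝ => (lam, δ)) atTop (atTop ×ˢ 𝓟 (Set.Icc δ T)) :=
      tendsto_id.prodMk (tendsto_principal.2 (Eventually.of_forall fun _ => ⟨le_rfl, hδT⟩))
    have hlt : 0 < Real.log ε - Real.log (ρ δ) :=
      sub_pos.2 (Real.log_lt_log (hρpos δ hδ) hρδ)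
    filter_upwards [(hD.comp hpair).eventually_lt_const hlt, eventually_gt_atTop 0]
      with lam h hlam
    have hS : 0 < S (lam * δ) := ha.trans (hSa _ (by positivity))
    have hr : 0 < R lam := by linarith [(hR lam hlam).1]
    simp only [Function.comp_apply] at h
    exact (Real.log_lt_log_iff (by positivity) hε).1 (by linarith)
  rw [Metric.tendstoUniformlyOn_iff]
  intro η hη
  have hb := eventually_prod_principal_iff.1 (hbound.eventually_lt_const hη)
  filter_upwards [hb, hsmall, eventually_gt_atTop 0] with lam hb hs hlam
  rintro ⟨x, t⟩ ⟨hx, ht0, htT⟩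
  simp only at hx ht0 htT ⊢
  have hr : 0 < R lam := by linarith [(hR lam hlam).1]
  have hx0 : 0 < ‖x‖ := hε.trans_le hx
  have hxne : x ≠ 0 := norm_pos_iff.1 hx0
  have hlt : 0 ≤ lam * t := by positivity
  have hS : 0 < S (lam * t) := ha.trans (hSa _ hlt)
  rw [hp _ (smul_ne_zero hr.ne' hxne) _ hlt, norm_smul, Real.norm_of_nonneg hr.le, dist_comm,
    Real.dist_eq, ← div_div (S (lam * t))]
  rcases le_total t δ with htδ | htδ
  · have h1 : S (lam * t) / R lam ≤ ‖x‖ := by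
      have hle : S (lam * t) ≤ S (lam * δ) :=
        hSmono hlt (by simp only [Set.mem_Ici]; positivity) (by gcongr)
      exact (div_le_div_of_nonneg_right hle hr.le).trans (hs.le.trans hx)
    have h2 : ρ t ≤ ‖x‖ := (hρmono htδ).trans (hρδ.le.trans hx)
    rw [max_eq_right (Real.log_nonpos (by positivity) ((div_le_one hx0).2 h1)),
      max_eq_right (Real.log_nonpos (by positivity) ((div_le_one hx0).2 h2))]
    simpa using hη
  · have ht : 0 < t := hδ.trans_le htδ
    have hρt : 0 < ρ t := hρpos t ht
    have hv : Real.log (ρ t / ‖x‖) ≤ M :=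
      Real.log_le_log (by positivity) (div_le_div₀ (hρpos T hT).le (hρmono htT) hε hx)
    have key := abs_mul_max_sub_le (c := Real.log (R lam) / Real.log (S (lam * t) / a))
      (u := Real.log (S (lam * t) / R lam / ‖x‖)) hv
    have huv : Real.log (S (lam * t) / R lam / ‖x‖) - Real.log (ρ t / ‖x‖) =
        Real.log (S (lam * t) / R lam) - Real.log (ρ t) := by
      rw [Real.log_div (by positivity) hx0.ne', Real.log_div hρt.ne' hx0.ne']
      ring
    rw [huv] at key
    refine lt_of_le_of_lt ?_ (hb t ⟨htδ, htT⟩)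
    refine le_trans (le_of_eq ?_) (mul_le_mul_of_nonneg_left key hA.le)
    rw [← abs_of_pos hA, ← abs_mul, abs_of_pos hA]
    congr 1
    ring
end

section
/- Let n ≥ 3 be an integer and let K ⊂ ℝⁿ be a compact set whose interior contains the origin. Let P : ℝⁿ \ interior(K) → ℝ be continuous, twice continuously differentiable on the open set ℝⁿ \ K with ΔP = 0 there, with P = 1 on ∂K and lim_{|x|→∞} P(x) = 0. Then there exists a constant C* ∈ ℝ such that lim_{|x|→∞} |x|^{n−2}·P(x) = C*. -/
open Real Filter

section Euclidean

open InnerProductSpace Topology Set Laplacian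

theorem norm_sq_rpow {E : Type*} [NormedAddCommGroup E] (x : E) (a : ℝ) :
    (‖x‖ ^ 2) ^ a = ‖x‖ ^ (2 * a) := by
  rw [← rpow_natCast, ← rpow_mul (norm_nonneg x)]
  norm_num

variable {E : Type*} [NormedAddCommGroup E] [InnerProductSpace ℝ E]

theorem iteratedFDeriv_two_eq_deriv_deriv {f : E → ℝ} {x : E} (hf : ContDiffAt ℝ 2 f x) (v : E) :
    iteratedFDeriv ℝ 2 f x ![v, v] = deriv (deriv fun t : ℝ => f (x + t • v)) 0 := by
  have hline : ∀ t : ℝ, HasDerivAt (fun t : ℝ => x + t • v) v t := fun t => by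
    simpa using ((hasDerivAt_id t).smul_const v).const_add x
  have h0 : x + (0 : ℝ) • v = x := by simp
  have hcont : Tendsto (fun t : ℝ => x + t • v) (𝓝 0) (𝓝 x) := by
    simpa [h0] using (hline 0).continuousAt.tendsto
  have h1 : (deriv fun t : ℝ => f (x + t • v)) =ᶠ[𝓝 0] fun t => fderiv ℝ f (x + t • v) v := by
    filter_upwards [hcont.eventually (hf.eventually (by simp))] with t ht
    exact ((ht.differentiableAt (by simp)).hasFDerivAt.comp_hasDerivAt t (hline t)).deriv
  rw [h1.deriv_eq, iteratedFDeriv_two_apply]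
  have h2 : DifferentiableAt ℝ (fderiv ℝ f) (x + (0 : ℝ) • v) := by
    rw [h0]
    exact (hf.fderiv_right (m := 1) (by norm_num)).differentiableAt (by simp)
  have h3 := h2.hasFDerivAt.comp_hasDerivAt (0 : ℝ) (hline 0)
  rw [h0] at h3
  have h4 := ((ContinuousLinearMap.apply ℝ ℝ v).hasFDerivAt.comp_hasDerivAt (0 : ℝ) h3).deriv
  exact h4.symm

theorem deriv_deriv_nonpos_of_isLocalMax {g : ℝ → ℝ} {a : ℝ} (hg : ContinuousAt g a)
    (h : IsLocalMax g a) : deriv (deriv g) a ≤ 0 := by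
  by_contra! hpos
  have hmin := isLocalMin_of_deriv_deriv_pos hpos h.deriv_eq_zero hg
  have hconst : g =ᶠ[𝓝 a] fun _ => g a := by
    filter_upwards [h, hmin] with t h1 h2 using le_antisymm h1 h2
  have := hconst.deriv.deriv_eq
  simp at this
  exact hpos.ne' this

theorem norm_add_smul_orthonormal_sq {ι : Type*} [Fintype ι] (b : OrthonormalBasis ι ℝ E)
    (x : E) (i : ι) (t : ℝ) : ‖x + t • b i‖ ^ 2 = ‖x‖ ^ 2 + 2 * t * inner ℝ (b i) x + t ^ 2 := by
  rw [norm_add_sq_real, inner_smul_right, real_inner_comm, norm_smul, b.norm_eq_one]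
  simp; ring

theorem deriv_deriv_affine_mul_rpow {N : ℝ} (hN : 0 < N) (C m k a : ℝ) :
    deriv (deriv fun t : ℝ => (C + t * m) * (N + 2 * t * k + t ^ 2) ^ a) 0 =
      4 * a * N ^ (a - 1) * (m * k) + 4 * a * (a - 1) * C * N ^ (a - 2) * k ^ 2
        + 2 * a * C * N ^ (a - 1) := by
  have hq : ∀ t : ℝ, HasDerivAt (fun t : ℝ => N + 2 * t * k + t ^ 2) (2 * k + 2 * t) t := by
    intro t
    have := ((((hasDerivAt_id t).const_mul 2).mul_const k).const_add N).add
      ((hasDerivAt_id t).pow 2)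
    exact this.congr_deriv (by simp)
  have hl : ∀ t : ℝ, HasDerivAt (fun t : ℝ => C + t * m) m t := by
    intro t
    simpa using ((hasDerivAt_id t).mul_const m).const_add C
  have hd : ∀ t : ℝ, HasDerivAt (fun t : ℝ => 2 * k + 2 * t) 2 t := by
    intro t
    simpa using ((hasDerivAt_id t).const_mul 2).const_add (2 * k)
  have hev : ∀ᶠ t : ℝ in 𝓝 0, N + 2 * t * k + t ^ 2 ≠ 0 := by
    have hc := (hq 0).continuousAt
    exact hc.eventually_ne (by simpa using hN.ne')
  have h1 : (deriv fun t : ℝ => (C + t * m) * (N + 2 * t * k + t ^ 2) ^ a) =ᶠ[𝓝 0]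
      fun t => m * (N + 2 * t * k + t ^ 2) ^ a
        + (C + t * m) * ((2 * k + 2 * t) * a * (N + 2 * t * k + t ^ 2) ^ (a - 1)) := by
    filter_upwards [hev] with t ht
    exact ((hl t).mul ((hq t).rpow_const (Or.inl ht))).deriv
  rw [h1.deriv_eq]
  have h0 := hev.self_of_nhds
  have h2 := (((hq 0).rpow_const (p := a) (Or.inl h0)).const_mul m).add
    ((hl 0).mul (((hd 0).mul_const a).mul ((hq 0).rpow_const (p := a - 1) (Or.inl h0))))
  refine h2.deriv.trans ?_
  simp only [Pi.mul_apply, mul_zero, zero_mul, add_zero, zero_pow two_ne_zero,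
    show a - 1 - 1 = a - 2 by ring]
  ring

theorem contDiffAt_affine_mul_norm_rpow (c : ℝ) (e : E) (a : ℝ) {x : E} (hx : x ≠ 0) :
    ContDiffAt ℝ 2 (fun y : E => (c + inner ℝ e y) * (‖y‖ ^ 2) ^ a) x := by
  have hx2 : ‖x‖ ^ 2 ≠ 0 := by simpa using hx
  have h2 : ContDiffAt ℝ 2 (fun y : E => ‖y‖ ^ 2) x := (contDiff_norm_sq ℝ).contDiffAt
  have h1 : ContDiffAt ℝ 2 (fun y : E => c + inner ℝ e y) x :=
    contDiffAt_const.add (contDiffAt_const.inner ℝ contDiffAt_id)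
  exact h1.mul (h2.rpow_const_of_ne hx2)

theorem sub_reflection_orthogonal_singleton (e z : E) :
    z - (ℝ ∙ e)ᗮ.reflection z = (2 * (inner ℝ e z / ‖e‖ ^ 2)) • e := by
  rw [Submodule.reflection_orthogonal_apply, Submodule.reflection_singleton_apply]
  simp only [RCLike.ofReal_real_eq_id, id]
  module

variable [FiniteDimensional ℝ E]

theorem laplacian_eq_sum_deriv_deriv {ι : Type*} [Fintype ι] (b : OrthonormalBasis ι ℝ E)
    {f : E → ℝ} {x : E} (hf : ContDiffAt ℝ 2 f x) :
    Δ f x = ∑ i, deriv (deriv fun t : ℝ => f (x + t • b i)) 0 := by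
  rw [laplacian_eq_iteratedFDeriv_orthonormalBasis f b]
  exact Finset.sum_congr rfl fun i _ => iteratedFDeriv_two_eq_deriv_deriv hf _

theorem laplacian_nonpos_of_isLocalMax {f : E → ℝ} {x : E} (hf : ContDiffAt ℝ 2 f x)
    (h : IsLocalMax f x) : Δ f x ≤ 0 := by
  rw [laplacian_eq_sum_deriv_deriv (stdOrthonormalBasis ℝ E) hf]
  refine Finset.sum_nonpos fun i _ => ?_
  have hline : ContinuousAt (fun t : ℝ => x + t • stdOrthonormalBasis ℝ E i) 0 := by fun_prop
  have h0 : x + (0 : ℝ) • stdOrthonormalBasis ℝ E i = x := by simp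
  apply deriv_deriv_nonpos_of_isLocalMax
  · exact ContinuousAt.comp (g := f) (by rw [h0]; exact hf.continuousAt) hline
  · have : IsLocalMax f (x + (0 : ℝ) • stdOrthonormalBasis ℝ E i) := by rwa [h0]
    exact IsLocalMax.comp_continuous (g := fun t : ℝ => x + t • stdOrthonormalBasis ℝ E i)
      this hline

theorem laplacian_norm_sq (x : E) :
    Δ (fun y : E => ‖y‖ ^ 2) x = 2 * Module.finrank ℝ E := by
  rw [laplacian_eq_sum_deriv_deriv (stdOrthonormalBasis ℝ E) (contDiff_norm_sq ℝ).contDiffAt]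
  simp_rw [norm_add_smul_orthonormal_sq]
  have : ∀ c d : ℝ, deriv (deriv fun t : ℝ => c + 2 * t * d + t ^ 2) 0 = 2 := by
    intro c d
    have h1 : (deriv fun t : ℝ => c + 2 * t * d + t ^ 2) = fun t => 2 * d + 2 * t := by
      funext t
      have := (((((hasDerivAt_id t).const_mul 2).mul_const d).const_add c).add
        ((hasDerivAt_id t).pow 2))
      refine (this.congr_deriv ?_).deriv
      simp
    rw [h1]
    simp
  simp_rw [this]
  simp [mul_comm]

theorem InnerProductSpace.HarmonicAt.comp_linearIsometryEquiv {f : E → ℝ} (S : E ≃ₗᵢ[ℝ] E) {x : E}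
    (hf : HarmonicAt f (S x)) : HarmonicAt (fun y => f (S y)) x := by
  have key : ∀ y, ContDiffAt ℝ 2 f (S y) →
      Δ (fun y => f (S y)) y = Δ f (S y) := by
    intro y hy
    have h1 : ContDiffAt ℝ 2 (fun y => f (S y)) y :=
      hy.comp y (S.toContinuousLinearEquiv.contDiff.contDiffAt)
    rw [laplacian_eq_sum_deriv_deriv (stdOrthonormalBasis ℝ E) h1,
      laplacian_eq_sum_deriv_deriv ((stdOrthonormalBasis ℝ E).map S) hy]
    simp
  have hS : Tendsto S (𝓝 x) (𝓝 (S x)) := S.continuous.tendsto x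
  refine ⟨hf.1.comp x (S.toContinuousLinearEquiv.contDiff.contDiffAt), ?_⟩
  filter_upwards [hS.eventually hf.2, hS.eventually (hf.1.eventually (by simp))] with y h1 h2
  rw [key y h2, h1]
  rfl

/-- Weak maximum principle on a possibly unbounded set, for functions vanishing at infinity. -/
theorem nonpos_of_harmonicAt [Nontrivial E] {v : E → ℝ} {Ω F : Set E} (hΩ : IsOpen Ω)
    (hF : IsClosed F) (hΩF : Ω ⊆ F) (hv : ∀ x ∈ Ω, HarmonicAt v x) (hc : ContinuousOn v F)
    (hb : ∀ x ∈ F \ Ω, v x ≤ 0) (hinf : Tendsto v (cocompact E) (𝓝 0)) :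
    ∀ x ∈ F, v x ≤ 0 := by
  intro x₀ hx₀
  by_contra! hpos
  obtain ⟨ρ₀, hρ₀⟩ : ∃ ρ₀ : ℝ, ∀ x : E, ρ₀ ≤ ‖x‖ → v x < v x₀ / 2 := by
    have := hinf.eventually (gt_mem_nhds (half_pos hpos))
    rw [← comap_norm_atTop.trans Metric.cobounded_eq_cocompact, eventually_comap,
      eventually_atTop] at this
    obtain ⟨ρ, h⟩ := this
    exact ⟨ρ, fun x hx => h _ hx x rfl⟩
  obtain ⟨ρ, hρ, hρpos⟩ : ∃ ρ, ρ₀ ≤ ρ ∧ 0 < ρ := ⟨max ρ₀ 1, le_max_left _ _, by positivity⟩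
  set ε : ℝ := v x₀ / (4 * ρ ^ 2) with hε
  have hεpos : 0 < ε := by positivity
  have hερ : ε * ρ ^ 2 = v x₀ / 4 := by rw [hε]; field_simp
  have hx₀ρ : ‖x₀‖ < ρ := by
    by_contra! h
    linarith [hρ₀ x₀ (hρ.trans h)]
  have hcomp : IsCompact (F ∩ Metric.closedBall 0 ρ) :=
    (isCompact_closedBall (0 : E) ρ).inter_left hF
  set q : E → ℝ := fun y => ‖y‖ ^ 2 with hq
  set w : E → ℝ := v + ε • q with hw
  have hwc : ContinuousOn w (F ∩ Metric.closedBall 0 ρ) :=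
    (hc.mono inter_subset_left).add (by fun_prop)
  obtain ⟨z, hz, hmax⟩ := hcomp.exists_isMaxOn ⟨x₀, hx₀, by simpa using hx₀ρ.le⟩ hwc
  have hzρ : ‖z‖ ≤ ρ := by simpa using hz.2
  have hwz : v x₀ ≤ w z := by
    refine le_trans ?_ (hmax ⟨hx₀, by simpa using hx₀ρ.le⟩)
    simp only [hw, hq, Pi.add_apply, Pi.smul_apply, smul_eq_mul]
    nlinarith [sq_nonneg ‖x₀‖]
  have hvz : 3 / 4 * v x₀ ≤ v z := by
    simp only [hw, hq, Pi.add_apply, Pi.smul_apply, smul_eq_mul] at hwz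
    have : ε * ‖z‖ ^ 2 ≤ ε * ρ ^ 2 := by gcongr
    linarith
  have hzΩ : z ∈ Ω := by
    by_contra h
    linarith [hb z ⟨hz.1, h⟩]
  have hzρ' : ‖z‖ < ρ := by
    by_contra! h
    linarith [hρ₀ z (hρ.trans h)]
  have hloc : IsLocalMax w z := by
    filter_upwards [hΩ.mem_nhds hzΩ, Metric.isOpen_ball.mem_nhds
      (show z ∈ Metric.ball (0 : E) ρ by simpa using hzρ')] with y h1 h2
    exact hmax ⟨hΩF h1, Metric.ball_subset_closedBall h2⟩
  have hn : ContDiffAt ℝ 2 q z := (contDiff_norm_sq ℝ).contDiffAt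
  have hεn : ContDiffAt ℝ 2 (ε • q) z := hn.const_smul ε
  have hlap : Δ (v + ε • q) z ≤ 0 :=
    laplacian_nonpos_of_isLocalMax ((hv z hzΩ).1.add hεn) hloc
  rw [(hv z hzΩ).1.laplacian_add hεn, laplacian_smul ε hn, laplacian_norm_sq,
    (hv z hzΩ).2.eq_of_nhds] at hlap
  have : (0 : ℝ) < Module.finrank ℝ E := by exact_mod_cast Module.finrank_pos
  simp only [Pi.zero_apply, smul_eq_mul, zero_add] at hlap
  have : 0 < ε * (2 * Module.finrank ℝ E) := by positivity
  linarith

theorem laplacian_affine_mul_norm_rpow (c : ℝ) (e : E) (a : ℝ) {x : E} (hx : x ≠ 0) :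
    Δ (fun y : E => (c + inner ℝ e y) * (‖y‖ ^ 2) ^ a) x =
      2 * a * (‖x‖ ^ 2) ^ (a - 1) *
        (2 * inner ℝ e x + (2 * (a - 1) + Module.finrank ℝ E) * (c + inner ℝ e x)) := by
  have hN : 0 < ‖x‖ ^ 2 := by positivity
  set b := stdOrthonormalBasis ℝ E
  rw [laplacian_eq_sum_deriv_deriv b (contDiffAt_affine_mul_norm_rpow c e a hx)]
  simp_rw [norm_add_smul_orthonormal_sq, inner_add_right, inner_smul_right, ← add_assoc]
  simp_rw [deriv_deriv_affine_mul_rpow hN]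
  rw [Finset.sum_add_distrib, Finset.sum_add_distrib, ← Finset.mul_sum, ← Finset.mul_sum,
    b.sum_inner_mul_inner]
  have h2 : ∑ i, inner ℝ (b i) x ^ 2 = ‖x‖ ^ 2 := by
    rw [← b.sum_sq_norm_inner_right x]
    simp
  have h3 : (‖x‖ ^ 2) ^ (a - 1) = (‖x‖ ^ 2) ^ (a - 2) * ‖x‖ ^ 2 := by
    rw [← rpow_add_one hN.ne']
    ring_nf
  rw [h2]
  simp only [Finset.sum_const, Finset.card_univ, Fintype.card_fin, nsmul_eq_mul]
  rw [h3]
  ring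

theorem harmonicAt_norm_rpow {x : E} (hx : x ≠ 0) :
    HarmonicAt (fun y : E => (‖y‖ ^ 2) ^ (1 - (Module.finrank ℝ E : ℝ) / 2)) x := by
  have h := contDiffAt_affine_mul_norm_rpow 1 (0 : E) (1 - (Module.finrank ℝ E : ℝ) / 2) hx
  have h' : ∀ y : E, y ≠ 0 → _ := fun y hy =>
    laplacian_affine_mul_norm_rpow 1 (0 : E) (1 - (Module.finrank ℝ E : ℝ) / 2) hy
  simp only [inner_zero_left, add_zero, one_mul] at h h'
  refine ⟨h, ?_⟩
  filter_upwards [isOpen_ne.mem_nhds hx] with y hy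
  rw [h' y hy, Pi.zero_apply]
  ring

theorem harmonicAt_inner_mul_norm_rpow (e : E) {x : E} (hx : x ≠ 0) :
    HarmonicAt (fun y : E => inner ℝ e y * (‖y‖ ^ 2) ^ (-(Module.finrank ℝ E : ℝ) / 2)) x := by
  have h := contDiffAt_affine_mul_norm_rpow 0 e (-(Module.finrank ℝ E : ℝ) / 2) hx
  have h' : ∀ y : E, y ≠ 0 → _ := fun y hy =>
    laplacian_affine_mul_norm_rpow 0 e (-(Module.finrank ℝ E : ℝ) / 2) hy
  simp only [zero_add] at h h'
  refine ⟨h, ?_⟩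
  filter_upwards [isOpen_ne.mem_nhds hx] with y hy
  rw [h' y hy, Pi.zero_apply]
  ring

theorem tendsto_norm_rpow_cocompact {a : ℝ} (ha : a < 0) :
    Tendsto (fun x : E => ‖x‖ ^ a) (cocompact E) (𝓝 0) := by
  have := (tendsto_rpow_neg_atTop (neg_pos.2 ha)).comp (tendsto_norm_cocompact_atTop (E := E))
  simpa [Function.comp_def] using this

theorem tendsto_inner_mul_norm_rpow_cocompact (e : E) {a : ℝ} (ha : 2 * a < -1) :
    Tendsto (fun x : E => inner ℝ e x * (‖x‖ ^ 2) ^ a) (cocompact E) (𝓝 0) := by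
  have h := (tendsto_norm_rpow_cocompact (E := E) (show 1 + 2 * a < 0 by linarith)).const_mul ‖e‖
  rw [mul_zero] at h
  refine squeeze_zero_norm' ?_ h
  have hne : ∀ᶠ x : E in cocompact E, 0 < ‖x‖ :=
    (tendsto_norm_cocompact_atTop (E := E)).eventually_gt_atTop 0
  filter_upwards [hne] with x hx
  rw [norm_sq_rpow, norm_mul, norm_of_nonneg (rpow_nonneg (norm_nonneg x) _), rpow_add hx,
    rpow_one, ← mul_assoc]
  gcongr
  exact norm_inner_le_norm e x

theorem exists_lipschitz_sphere {P : E → ℝ} {R : ℝ}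
    (hP : ∀ x : E, R ≤ ‖x‖ → HarmonicAt P x) :
    ∃ L : ℝ, 0 ≤ L ∧ ∀ x y : E, ‖x‖ = R → ‖y‖ = R → |P x - P y| ≤ L * ‖x - y‖ := by
  have hloc : LocallyLipschitzOn (Metric.sphere (0 : E) R) P := by
    intro x hx
    have h1 : ContDiffAt ℝ 1 P x :=
      (hP x (by simpa using (mem_sphere_zero_iff_norm.1 hx).ge)).1.of_le (by norm_num)
    obtain ⟨K, t, ht, hK⟩ := h1.exists_lipschitzOnWith
    exact ⟨K, t, mem_nhdsWithin_of_mem_nhds ht, hK⟩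
  obtain ⟨L, hL⟩ := hloc.exists_lipschitzOnWith_of_compact (isCompact_sphere (0 : E) R)
  refine ⟨L, L.2, fun x y hx hy => ?_⟩
  have := hL.dist_le_mul x (by simpa using hx) y (by simpa using hy)
  rwa [dist_eq_norm, dist_eq_norm, norm_eq_abs] at this

/-- The oscillation over spheres of an exterior harmonic function vanishing at infinity decays like
the dipole potential. -/
theorem exists_sub_le_of_norm_eq [Nontrivial E] (hd : 1 < Module.finrank ℝ E) {P : E → ℝ} {R : ℝ}
    (hR : 0 < R) (hP : ∀ x : E, R ≤ ‖x‖ → HarmonicAt P x) (hinf : Tendsto P (cocompact E) (𝓝 0)) :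
    ∃ C : ℝ, 0 ≤ C ∧ ∀ x y : E, R ≤ ‖x‖ → ‖x‖ = ‖y‖ →
      P x - P y ≤ C * ‖x‖ ^ (1 - (Module.finrank ℝ E : ℝ)) := by
  obtain ⟨L, hL0, hL⟩ := exists_lipschitz_sphere hP
  set d : ℝ := (Module.finrank ℝ E : ℝ) with hd_def
  have hd1 : (1 : ℝ) < d := by rw [hd_def]; exact_mod_cast hd
  refine ⟨2 * L * R ^ d, by positivity, fun x y hx hxy => ?_⟩
  have hxpos : 0 < ‖x‖ := hR.trans_le hx
  rcases eq_or_ne x y with rfl | hne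
  · rw [sub_self]; positivity
  set e : E := x - y with he
  have he0 : 0 < ‖e‖ := norm_pos_iff.2 (sub_ne_zero.2 hne)
  set S := (ℝ ∙ e)ᗮ.reflection with hS
  have hSx : S x = y := Submodule.reflection_sub hxy
  set A : ℝ := 2 * L * R ^ d / ‖e‖ with hA
  have hA0 : 0 ≤ A := by positivity
  set D : E → ℝ := fun z => inner ℝ e z * (‖z‖ ^ 2) ^ (-d / 2) with hD
  have hPS : ∀ z : E, R ≤ ‖z‖ → HarmonicAt (fun z => P (S z)) z := fun z hz =>
    HarmonicAt.comp_linearIsometryEquiv S (hP _ (by rwa [S.norm_map]))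
  have hharm : ∀ z : E, R ≤ ‖z‖ → HarmonicAt (P - (fun z => P (S z)) - A • D) z := fun z hz =>
    ((hP z hz).sub (hPS z hz)).sub
      (harmonicAt_inner_mul_norm_rpow e (norm_pos_iff.1 (hR.trans_le hz))).const_smul
  have hSinf : Tendsto (fun z => P (S z)) (cocompact E) (𝓝 0) :=
    hinf.comp S.toHomeomorph.isClosedEmbedding.tendsto_cocompact
  have hDinf : Tendsto (A • D) (cocompact E) (𝓝 0) := by
    have := (tendsto_inner_mul_norm_rpow_cocompact e
      (show 2 * (-d / 2) < -1 by linarith)).const_smul A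
    simpa using! this
  have hvinf : Tendsto (P - (fun z => P (S z)) - A • D) (cocompact E) (𝓝 0) := by
    simpa using! (hinf.sub hSinf).sub hDinf
  have hinner : Continuous fun z : E => inner ℝ e z := by fun_prop
  have key := nonpos_of_harmonicAt (Ω := {z : E | R < ‖z‖} ∩ {z : E | 0 < inner ℝ e z})
    (F := {z : E | R ≤ ‖z‖} ∩ {z : E | 0 ≤ inner ℝ e z})
    ((isOpen_lt continuous_const continuous_norm).inter (isOpen_lt continuous_const hinner))
    ((isClosed_le continuous_const continuous_norm).inter (isClosed_le continuous_const hinner))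
    (inter_subset_inter (ofPred_subset_ofPred.2 fun _ h => h.le)
      (ofPred_subset_ofPred.2 fun _ h => h.le))
    (fun z hz => hharm z (le_of_lt hz.1))
    (fun z hz => (hharm z hz.1).1.continuousAt.continuousWithinAt) ?_ hvinf x ⟨hx, ?_⟩
  · simp only [Pi.sub_apply, Pi.smul_apply, smul_eq_mul, hSx, hD] at key
    have h1 : inner ℝ e x ≤ ‖e‖ * ‖x‖ := real_inner_le_norm e x
    have h2 : A * (inner ℝ e x * (‖x‖ ^ 2) ^ (-d / 2))
        ≤ A * ((‖e‖ * ‖x‖) * (‖x‖ ^ 2) ^ (-d / 2)) := by gcongr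
    have h3 : A * ((‖e‖ * ‖x‖) * (‖x‖ ^ 2) ^ (-d / 2)) = 2 * L * R ^ d * ‖x‖ ^ (1 - d) := by
      rw [norm_sq_rpow, show 2 * (-d / 2) = -d by ring, sub_eq_add_neg, rpow_add hxpos, rpow_one,
        hA]
      field_simp
    linarith
  · rintro z ⟨⟨hz1, hz2⟩, hz3⟩
    simp only [mem_ofPred_eq] at hz1 hz2
    simp only [Pi.sub_apply, Pi.smul_apply, smul_eq_mul, hD]
    have hzS := sub_reflection_orthogonal_singleton e z
    rcases hz2.eq_or_lt with h0 | h0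
    · have : S z = z := by
        rw [← h0] at hzS
        simp only [zero_div, mul_zero, zero_smul] at hzS
        exact (sub_eq_zero.1 hzS).symm
      rw [this, ← h0]
      simp
    · have hzR : ‖z‖ = R := by
        by_contra h
        exact hz3 ⟨lt_of_le_of_ne hz1 (Ne.symm h), h0⟩
      have h1 := (le_abs_self _).trans (hL z (S z) hzR (by rw [S.norm_map, hzR]))
      have h2 : ‖z - S z‖ = 2 * inner ℝ e z / ‖e‖ := by
        rw [hzS, norm_smul, norm_of_nonneg (by positivity)]
        field_simp
      rw [h2] at h1
      have h3 : A * (inner ℝ e z * (‖z‖ ^ 2) ^ (-d / 2)) = L * (2 * inner ℝ e z / ‖e‖) := by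
        rw [norm_sq_rpow, hzR, show 2 * (-d / 2) = -d by ring, rpow_neg hR.le, hA]
        field_simp
      linarith
  · have h1 : inner ℝ e x = ‖x‖ ^ 2 - inner ℝ y x := by
      rw [he, inner_sub_left, real_inner_self_eq_norm_sq]
    have h2 := real_inner_le_norm y x
    rw [← hxy] at h2
    simp only [mem_ofPred_eq, h1]
    nlinarith

/-- A bound on the Kelvin-rescaled values over a sphere persists outside that sphere. -/
theorem abs_norm_rpow_mul_sub_le [Nontrivial E] (hd : 2 < Module.finrank ℝ E) {P : E → ℝ}
    {r c δ : ℝ} (hr : 0 < r) (hP : ∀ x : E, r ≤ ‖x‖ → HarmonicAt P x)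
    (hinf : Tendsto P (cocompact E) (𝓝 0))
    (hb : ∀ x : E, ‖x‖ = r → |‖x‖ ^ ((Module.finrank ℝ E : ℝ) - 2) * P x - c| ≤ δ) :
    ∀ x : E, r ≤ ‖x‖ → |‖x‖ ^ ((Module.finrank ℝ E : ℝ) - 2) * P x - c| ≤ δ := by
  set d : ℝ := (Module.finrank ℝ E : ℝ) with hd_def
  have hd2 : (2 : ℝ) < d := by rw [hd_def]; exact_mod_cast hd
  set Φ : E → ℝ := fun y => (‖y‖ ^ 2) ^ (1 - d / 2) with hΦ
  have hΦpos : ∀ x : E, r ≤ ‖x‖ → 0 < Φ x := fun x hx => by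
    have : 0 < ‖x‖ := hr.trans_le hx
    positivity
  have hΦmul : ∀ x : E, r ≤ ‖x‖ → ‖x‖ ^ (d - 2) * Φ x = 1 := fun x hx => by
    simp only [hΦ]
    rw [norm_sq_rpow, ← rpow_add (hr.trans_le hx)]
    ring_nf
    exact rpow_zero _
  have hΦinf : ∀ b : ℝ, Tendsto (b • Φ) (cocompact E) (𝓝 0) := fun b => by
    have := (tendsto_norm_rpow_cocompact (E := E)
      (show 2 * (1 - d / 2) < 0 by linarith)).const_smul b
    simp_rw [← norm_sq_rpow] at this
    simpa using! this
  have hΦharm : ∀ b : ℝ, ∀ x : E, r ≤ ‖x‖ → HarmonicAt (b • Φ) x := fun b x hx =>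
    (harmonicAt_norm_rpow (norm_pos_iff.1 (hr.trans_le hx))).const_smul
  have hmax : ∀ v : E → ℝ, (∀ x : E, r ≤ ‖x‖ → HarmonicAt v x) →
      Tendsto v (cocompact E) (𝓝 0) → (∀ x : E, ‖x‖ = r → v x ≤ 0) →
      ∀ x : E, r ≤ ‖x‖ → v x ≤ 0 := fun v hv hvinf hvb =>
    nonpos_of_harmonicAt (Ω := {z : E | r < ‖z‖}) (F := {z : E | r ≤ ‖z‖})
      (isOpen_lt continuous_const continuous_norm) (isClosed_le continuous_const continuous_norm)
      (ofPred_subset_ofPred.2 fun _ h => h.le) (fun z hz => hv z (le_of_lt hz))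
      (fun z hz => (hv z hz).1.continuousAt.continuousWithinAt)
      (fun z hz => hvb z (le_antisymm (not_lt.1 hz.2) hz.1)) hvinf
  have hrescale : ∀ x : E, r ≤ ‖x‖ → P x = Φ x * (‖x‖ ^ (d - 2) * P x) := fun x hx => by
    rw [← mul_assoc, mul_comm (Φ x), hΦmul x hx, one_mul]
  have hupper := hmax (P - (c + δ) • Φ) (fun x hx => (hP x hx).sub (hΦharm _ x hx))
    (by simpa using! hinf.sub (hΦinf (c + δ))) fun x hx => by
      have h1 := (abs_le.1 (hb x hx)).2
      have h2 := hΦpos x hx.ge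
      simp only [Pi.sub_apply, Pi.smul_apply, smul_eq_mul]
      rw [hrescale x hx.ge]
      nlinarith
  have hlower := hmax ((c - δ) • Φ - P) (fun x hx => (hΦharm _ x hx).sub (hP x hx))
    (by simpa using! (hΦinf (c - δ)).sub hinf) fun x hx => by
      have h1 := (abs_le.1 (hb x hx)).1
      have h2 := hΦpos x hx.ge
      simp only [Pi.sub_apply, Pi.smul_apply, smul_eq_mul]
      rw [hrescale x hx.ge]
      nlinarith
  intro x hx
  have h1 := hupper x hx
  have h2 := hlower x hx
  have h3 := hΦpos x hx
  simp only [Pi.sub_apply, Pi.smul_apply, smul_eq_mul] at h1 h2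
  rw [hrescale x hx] at h1 h2
  rw [abs_le]
  constructor <;> nlinarith

theorem exists_tendsto_norm_rpow_mul [Nontrivial E] (hd : 2 < Module.finrank ℝ E) {P : E → ℝ}
    {R : ℝ} (hR : 0 < R) (hP : ∀ x : E, R ≤ ‖x‖ → HarmonicAt P x)
    (hinf : Tendsto P (cocompact E) (𝓝 0)) :
    ∃ c : ℝ, Tendsto (fun x : E => ‖x‖ ^ ((Module.finrank ℝ E : ℝ) - 2) * P x)
      (cocompact E) (𝓝 c) := by
  obtain ⟨C, hC0, hC⟩ := exists_sub_le_of_norm_eq (by omega) hR hP hinf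
  have : NoncompactSpace E := NormedSpace.noncompactSpace ℝ E
  rw [← cauchy_map_iff_exists_tendsto, Metric.cauchy_iff]
  refine ⟨inferInstance, fun ε hε => ?_⟩
  set d : ℝ := (Module.finrank ℝ E : ℝ) with hd_def
  set r : ℝ := max R (4 * C / ε + 1) with hr_def
  have hRr : R ≤ r := le_max_left _ _
  have hr : 0 < r := hR.trans_le hRr
  have hCr : C / r < ε / 4 := by
    have : 4 * C / ε + 1 ≤ r := le_max_right _ _
    rw [div_lt_iff₀ hr]
    have h1 : 4 * C / ε < r := by linarith
    rw [div_lt_iff₀ hε] at h1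
    linarith
  obtain ⟨p, hp⟩ := exists_norm_eq E hr.le
  have key := abs_norm_rpow_mul_sub_le hd (c := r ^ (d - 2) * P p) (δ := C / r) hr
    (fun x hx => hP x (hRr.trans hx)) hinf fun x hx => by
      have h1 := hC x p (by rwa [hx]) (by rw [hx, hp])
      have h2 := hC p x (by rwa [hp]) (by rw [hx, hp])
      rw [hx] at h1
      rw [hp] at h2
      have h3 : r ^ (d - 2) * (C * r ^ (1 - d)) = C / r := by
        rw [mul_left_comm, ← rpow_add hr, show d - 2 + (1 - d) = -1 by ring, rpow_neg_one,
          div_eq_mul_inv]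
      have h4 : 0 ≤ r ^ (d - 2) := by positivity
      rw [hx, ← mul_sub, abs_le, ← h3]
      constructor <;> nlinarith
  refine ⟨_, image_mem_map (show {x : E | r ≤ ‖x‖} ∈ cocompact E from
    (tendsto_norm_cocompact_atTop (E := E)).eventually_ge_atTop r), ?_⟩
  rintro _ ⟨x, hx, rfl⟩ _ ⟨y, hy, rfl⟩
  rw [Real.dist_eq, abs_lt]
  have h1 := abs_le.1 (key x hx)
  have h2 := abs_le.1 (key y hy)
  constructor <;> linarith [h1.1, h1.2, h2.1, h2.2]

theorem laplacian_eq_sum_fderiv_fderiv {n : ℕ} (f : EuclideanSpace ℝ (Fin n) → ℝ)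
    {x : EuclideanSpace ℝ (Fin n)} (hf : ContDiffAt ℝ 2 f x) :
    Δ f x = ∑ i : Fin n, fderiv ℝ (fun y => fderiv ℝ f y (EuclideanSpace.single i 1)) x
      (EuclideanSpace.single i 1) := by
  have h : DifferentiableAt ℝ (fderiv ℝ f) x :=
    (hf.fderiv_right (m := 1) (by norm_num)).differentiableAt (by simp)
  rw [laplacian_eq_iteratedFDeriv_orthonormalBasis f (EuclideanSpace.basisFun (Fin n) ℝ)]
  refine Finset.sum_congr rfl fun i _ => ?_
  rw [iteratedFDeriv_two_apply, fderiv_clm_apply h (by fun_prop)]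
  simp

end Euclidean

open Real Filter

/-- Asymptotics of the exterior Dirichlet problem, `n ≥ 3`: if `P` is continuous on
`ℝⁿ \ interior K`, harmonic (C² with vanishing Laplacian, expressed as the sum of second
partial derivatives) on `ℝⁿ \ K`, equal to `1` on `∂K` and tending to `0` at infinity,
then there is a constant `C*` with `lim_{|x|→∞} |x|^{n−2} P(x) = C*`. -/
theorem stmt_18 (n : ℕ) (hn : 3 ≤ n)
    (K : Set (EuclideanSpace ℝ (Fin n))) (hK : IsCompact K)
    (h0 : (0 : EuclideanSpace ℝ (Fin n)) ∈ interior K)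
    (P : EuclideanSpace ℝ (Fin n) → ℝ)
    (hPcont : ContinuousOn P (interior K)ᶜ)
    (hPC2 : ContDiffOn ℝ 2 P Kᶜ)
    (hHarm : ∀ x : EuclideanSpace ℝ (Fin n), x ∉ K →
      (∑ i : Fin n,
        fderiv ℝ (fun y => fderiv ℝ P y (EuclideanSpace.single i 1)) x
          (EuclideanSpace.single i 1)) = 0)
    (hPbdry : ∀ x ∈ frontier K, P x = 1)
    (hPinf : Tendsto P (Filter.cocompact (EuclideanSpace ℝ (Fin n))) (nhds 0)) :
    ∃ Cstar : ℝ,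
      Tendsto (fun x : EuclideanSpace ℝ (Fin n) => ‖x‖ ^ ((n : ℝ) - 2) * P x)
        (Filter.cocompact (EuclideanSpace ℝ (Fin n))) (nhds Cstar) := by
  have hmem : ∀ x ∉ K, Kᶜ ∈ nhds x := fun x hx => hK.isClosed.isOpen_compl.mem_nhds hx
  have hharm : ∀ x ∉ K, InnerProductSpace.HarmonicAt P x := fun x hx => by
    refine ⟨hPC2.contDiffAt (hmem x hx), ?_⟩
    filter_upwards [hmem x hx] with y hy
    rw [laplacian_eq_sum_fderiv_fderiv P (hPC2.contDiffAt (hmem y hy)), hHarm y hy, Pi.zero_apply]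
  obtain ⟨R, hR, hKR⟩ := hK.isBounded.exists_pos_norm_lt
  have : Nonempty (Fin n) := ⟨⟨0, by omega⟩⟩
  have := exists_tendsto_norm_rpow_mul (by rw [finrank_euclideanSpace_fin]; omega) hR
    (fun x hx => hharm x fun hxK => (hKR x hxK).not_ge hx) hPinf
  simpa using this
end
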